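/- arXiv:2108.00875 — 5 statements merged into one kernel-verified Lean document; each statement's English description precedes it below -/
import Mathlib

section
/- Let t_2 and N be two distinct light indices of {1,…,n} (both > n − m) and let k = (k_1,…,k_n) be a tuple of nonnegative integers. Set S′ := ({1,…,n}∖{t_2, N}) ∪ {★}, where ★ is a fresh light element carrying the integer exponent k_★ := k_{t_2} + k_N − 1, the other elements keeping their exponents. Then Σ_{P ∈ 𝒫_w({1,…,n}), t_2 and N in the same block of P} (−1)^{n−ℓ(P)} · M_k(P) = − Σ_{Q ∈ 𝒫_{w′}(S′)} (−1)^{|S′|−ℓ(Q)} · M_{k′}(Q), where w′ and k′ denote the induced weight and exponent data on S′. -/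
open Finset

/-- `P` is a partition of the finite set `S`: its blocks are nonempty, pairwise
disjoint, and their union is `S`. -/
def IsPartition {α : Type*} [DecidableEq α] (S : Finset α) (P : Finset (Finset α)) : Prop :=
  (∀ B ∈ P, B.Nonempty) ∧
  (∀ B ∈ P, ∀ B' ∈ P, B ≠ B' → Disjoint B B') ∧
  P.biUnion id = S

/-- A collection of blocks is totally `w`-unstable if each block has total weight at most 1. -/
def TotallyUnstable {α : Type*} (wfun : α → ℚ) (P : Finset (Finset α)) : Prop :=
  ∀ B ∈ P, ∑ i ∈ B, wfun i ≤ 1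

/-- The set `𝒫_w(S)` of totally `w`-unstable partitions of `S`. -/
noncomputable def unstablePartitions {α : Type*} [Fintype α] [DecidableEq α]
    (wfun : α → ℚ) (S : Finset α) : Finset (Finset (Finset α)) :=
  @Finset.filter _ (fun P => IsPartition S P ∧ TotallyUnstable wfun P)
    (Classical.decPred _) Finset.univ

/-- `K(P)_B = 1 - |B| + ∑_{j ∈ B} k j`. -/
def Kblock {α : Type*} (k : α → ℤ) (B : Finset α) : ℤ :=
  1 - B.card + ∑ j ∈ B, k j

/-- The multinomial coefficient `M_k(P) = (∑_B K(P)_B)! / ∏_B K(P)_B!`,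
taken to be `0` if some `K(P)_B` is negative. -/
def Mcoef {α : Type*} (k : α → ℤ) (P : Finset (Finset α)) : ℤ :=
  if ∀ B ∈ P, 0 ≤ Kblock k B then
    (Nat.multinomial P (fun B => (Kblock k B).toNat) : ℤ)
  else 0

/-- The heavy/light weight vector: weight `1` on the first `n - m` indices, `ε` on the rest. -/
def wt (n m : ℕ) (ε : ℚ) : Fin n → ℚ := fun i => if (i : ℕ) < n - m then 1 else ε

/-- Weights on the marked set enlarged by a fresh light element `★ = none`. -/
def wOpt (n m : ℕ) (ε : ℚ) : Option (Fin n) → ℚ :=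
  fun o => o.elim ε (wt n m ε)

section IsPartition

variable {α : Type*} [DecidableEq α]

lemma IsPartition.subset {S : Finset α} {P : Finset (Finset α)} (hP : IsPartition S P)
    {B : Finset α} (hB : B ∈ P) : B ⊆ S :=
  hP.2.2 ▸ subset_biUnion_of_mem id hB

lemma IsPartition.eq_of_mem {S : Finset α} {P : Finset (Finset α)} (hP : IsPartition S P)
    {B C : Finset α} (hB : B ∈ P) (hC : C ∈ P) {i : α} (hiB : i ∈ B) (hiC : i ∈ C) : B = C := by
  by_contra hne
  exact disjoint_left.1 (hP.2.1 B hB C hC hne) hiB hiC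

lemma IsPartition.card_le {S : Finset α} {P : Finset (Finset α)} (hP : IsPartition S P) :
    P.card ≤ S.card := by
  have h := card_biUnion (s := P) (t := id) hP.2.1
  rw [hP.2.2] at h
  rw [h, card_eq_sum_ones]
  exact sum_le_sum fun B hB => (hP.1 B hB).card_pos

end IsPartition

section SaturatedPartitions

variable {α β : Type*} [Fintype α] [DecidableEq β]

/-- The preimage of a finite set under a map out of a finite type. -/
def fintypePreimage (f : α → β) (B : Finset β) : Finset α :=
  univ.filter fun i => f i ∈ B

@[simp]
lemma mem_fintypePreimage {f : α → β} {B : Finset β} {i : α} :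
    i ∈ fintypePreimage f B ↔ f i ∈ B := by
  simp [fintypePreimage]

lemma image_fintypePreimage {f : α → β} {B : Finset β} (hB : B ⊆ univ.image f) :
    (fintypePreimage f B).image f = B := by
  ext b
  simp only [mem_image, mem_fintypePreimage]
  constructor
  · rintro ⟨a, ha, rfl⟩
    exact ha
  · intro hb
    obtain ⟨a, -, rfl⟩ := mem_image.1 (hB hb)
    exact ⟨a, hb, rfl⟩

lemma sum_fintypePreimage {M : Type*} [AddCommMonoid M] (f : α → β) (B : Finset β) (h : α → M) :
    ∑ i ∈ fintypePreimage f B, h i = ∑ b ∈ B, ∑ i with f i = b, h i := by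
  rw [← sum_fiberwise_of_maps_to (s := fintypePreimage f B) (t := B) (g := f) (by simp)]
  refine sum_congr rfl fun b hb => sum_congr ?_ fun _ _ => rfl
  ext i
  simp only [mem_filter, mem_fintypePreimage, mem_univ, true_and, and_iff_right_iff_imp]
  rintro rfl
  exact hb

variable [DecidableEq α]

lemma image_image_fintypePreimage {f : α → β} {Q : Finset (Finset β)}
    (hQ : IsPartition (univ.image f) Q) :
    (Q.image (fintypePreimage f)).image (image f) = Q := by
  rw [image_image]
  conv_rhs => rw [← image_id (s := Q)]
  exact image_congr fun B hB => image_fintypePreimage (hQ.subset hB)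

lemma IsPartition.image_fintypePreimage {f : α → β} {Q : Finset (Finset β)}
    (hQ : IsPartition (univ.image f) Q) : IsPartition univ (Q.image (fintypePreimage f)) := by
  refine ⟨?_, ?_, ?_⟩
  · simp only [forall_mem_image]
    intro B hB
    rw [← Finset.image_nonempty (f := f), _root_.image_fintypePreimage (hQ.subset hB)]
    exact hQ.1 B hB
  · simp only [forall_mem_image]
    intro B hB C hC hne
    rw [disjoint_left]
    intro i hiB hiC
    rw [mem_fintypePreimage] at hiB hiC
    exact hne (by rw [hQ.eq_of_mem hB hC hiB hiC])
  · ext i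
    have h : f i ∈ Q.biUnion id := by
      rw [hQ.2.2]
      exact mem_image_of_mem f (mem_univ i)
    simpa using h

lemma IsPartition.image_image {f : α → β} {P : Finset (Finset α)} (hP : IsPartition univ P)
    (hsat : ∀ B ∈ P, fintypePreimage f (B.image f) = B) :
    IsPartition (univ.image f) (P.image (image f)) := by
  refine ⟨?_, ?_, ?_⟩
  · simp only [forall_mem_image]
    intro B hB
    exact (hP.1 B hB).image f
  · simp only [forall_mem_image]
    intro B hB C hC hne
    rw [disjoint_left]
    intro b hbB hbC
    obtain ⟨i, hi, rfl⟩ := mem_image.1 hbB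
    have hiC : i ∈ C := by
      rw [← hsat C hC]
      exact mem_fintypePreimage.2 hbC
    exact hne (by rw [hP.eq_of_mem hB hC hi hiC])
  · ext b
    rw [← hP.2.2]
    simp only [mem_biUnion, mem_image, id]
    constructor
    · rintro ⟨_, ⟨B, hB, rfl⟩, hb⟩
      obtain ⟨i, hi, rfl⟩ := mem_image.1 hb
      exact ⟨i, ⟨B, hB, hi⟩, rfl⟩
    · rintro ⟨i, ⟨B, hB, hi⟩, rfl⟩
      exact ⟨_, ⟨B, hB, rfl⟩, mem_image_of_mem f hi⟩

end SaturatedPartitions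

lemma Kblock_eq_one_add_sum {α : Type*} (k : α → ℤ) (B : Finset α) :
    Kblock k B = 1 + ∑ j ∈ B, (k j - 1) := by
  simp only [Kblock, sum_sub_distrib, sum_const, nsmul_eq_mul, mul_one]
  ring

lemma Mcoef_image {α β : Type*} [DecidableEq α] (k : α → ℤ) (k' : β → ℤ)
    (Q : Finset (Finset β)) (g : Finset β → Finset α) (hg : Set.InjOn g Q)
    (hK : ∀ B ∈ Q, Kblock k (g B) = Kblock k' B) : Mcoef k (Q.image g) = Mcoef k' Q := by
  have hc : (∀ B ∈ Q.image g, 0 ≤ Kblock k B) ↔ ∀ B ∈ Q, 0 ≤ Kblock k' B := by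
    rw [forall_mem_image]
    exact forall₂_congr fun B hB => by rw [hK B hB]
  have hm : Nat.multinomial (Q.image g) (fun B => (Kblock k B).toNat) =
      Nat.multinomial Q (fun B => (Kblock k' B).toNat) := by
    simp only [Nat.multinomial]
    rw [sum_image hg, prod_image hg, sum_congr rfl fun B hB => by rw [hK B hB],
      prod_congr rfl fun B hB => by rw [hK B hB]]
  simp only [Mcoef, hc, hm]

lemma mem_unstablePartitions {α : Type*} [Fintype α] [DecidableEq α] {w : α → ℚ} {S : Finset α}
    {P : Finset (Finset α)} :
    P ∈ unstablePartitions w S ↔ IsPartition S P ∧ TotallyUnstable w P := by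
  simp [unstablePartitions]

/-- The map sending both `a` and `b` to `none` and fixing every other element. -/
def collide {α : Type*} [DecidableEq α] (a b : α) (i : α) : Option α :=
  if i = a ∨ i = b then none else some i

section Collide

variable {α : Type*} [DecidableEq α] {a b : α}

lemma collide_eq_none {i : α} : collide a b i = none ↔ i = a ∨ i = b := by
  unfold collide
  split_ifs with h <;> simp [h]

lemma collide_eq_some {i j : α} : collide a b i = some j ↔ (i ≠ a ∧ i ≠ b) ∧ i = j := by
  simp [collide]

variable [Fintype α]

lemma univ_image_collide :
    univ.image (collide a b) = insert none ((univ \ {a, b}).image some) := by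
  ext o
  cases o with
  | none => simp [collide_eq_none]
  | some j => simp [collide_eq_some]

lemma card_univ_image_collide (hab : a ≠ b) :
    (univ.image (collide a b)).card + 1 = Fintype.card α := by
  rw [univ_image_collide, card_insert_of_notMem (by simp),
    card_image_of_injective _ (Option.some_injective α), add_assoc, one_add_one_eq_two, ← card_pair hab,
    card_sdiff_add_card_eq_card (subset_univ _), card_univ]

lemma filter_collide_eq_none : (univ.filter fun i => collide a b i = none) = {a, b} := by
  ext i
  simp [collide_eq_none]

lemma filter_collide_eq_some {j : α} (hj : some j ∈ univ.image (collide a b)) :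
    (univ.filter fun i => collide a b i = some j) = {j} := by
  have hj' : j ≠ a ∧ j ≠ b := by simpa [collide_eq_some] using hj
  ext i
  simp only [mem_filter, mem_univ, true_and, collide_eq_some, mem_singleton]
  constructor
  · exact fun h => h.2
  · rintro rfl
    exact ⟨hj', rfl⟩

lemma Kblock_fintypePreimage_collide (hab : a ≠ b) (k : α → ℤ) {B : Finset (Option α)}
    (hB : B ⊆ univ.image (collide a b)) :
    Kblock k (fintypePreimage (collide a b) B) =
      Kblock (fun o => o.elim (k a + k b - 1) k) B := by
  rw [Kblock_eq_one_add_sum, Kblock_eq_one_add_sum, sum_fintypePreimage]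
  congr 1
  refine sum_congr rfl fun o ho => ?_
  cases o with
  | none =>
    rw [filter_collide_eq_none, sum_pair hab]
    simp only [Option.elim_none]
    ring
  | some j =>
    rw [filter_collide_eq_some (hB ho), sum_singleton, Option.elim_some]

lemma fintypePreimage_image_collide {P : Finset (Finset α)} (hP : IsPartition univ P)
    (h : ∃ B ∈ P, a ∈ B ∧ b ∈ B) {B : Finset α} (hB : B ∈ P) :
    fintypePreimage (collide a b) (B.image (collide a b)) = B := by
  obtain ⟨C, hC, haC, hbC⟩ := h
  ext i
  simp only [mem_fintypePreimage, mem_image]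
  constructor
  · rintro ⟨j, hj, hji⟩
    by_cases hi : i = a ∨ i = b
    · rw [collide_eq_none.2 hi, collide_eq_none] at hji
      have hjC : j ∈ C := by rcases hji with rfl | rfl <;> assumption
      rw [hP.eq_of_mem hB hC hj hjC]
      rcases hi with rfl | rfl <;> assumption
    · have hi' : collide a b i = some i := if_neg hi
      rw [hi', collide_eq_some] at hji
      exact hji.2 ▸ hj
  · exact fun hi => ⟨i, hi, rfl⟩

end Collide

lemma card_light_le (n m : ℕ) {B : Finset (Fin n)} (hB : ∀ i ∈ B, n - m ≤ (i : ℕ)) :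
    B.card ≤ m := by
  calc B.card = (B.image Fin.val).card := (card_image_of_injective _ Fin.val_injective).symm
    _ ≤ (Ico (n - m) n).card := card_le_card fun x hx => by
        obtain ⟨i, hi, rfl⟩ := mem_image.1 hx
        exact mem_Ico.2 ⟨hB i hi, i.2⟩
    _ ≤ m := by rw [Nat.card_Ico]; omega

lemma sum_wt_le_one_of_light {n m : ℕ} {ε : ℚ} (hε0 : 0 < ε) (hε1 : ε < 1 / (m : ℚ))
    {B : Finset (Fin n)} (hB : ∀ i ∈ B, n - m ≤ (i : ℕ)) : ∑ i ∈ B, wt n m ε i ≤ 1 := by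
  have hm : 0 < (m : ℚ) := one_div_pos.1 (hε0.trans hε1)
  have hcard : (B.card : ℚ) ≤ m := by exact_mod_cast card_light_le n m hB
  have hsum : ∑ i ∈ B, wt n m ε i = B.card * ε := by
    rw [← nsmul_eq_mul]
    exact sum_eq_card_nsmul fun i hi => if_neg (not_lt.2 (hB i hi))
  rw [hsum]
  calc (B.card : ℚ) * ε ≤ m * ε := by gcongr
    _ ≤ m * (1 / m) := by gcongr
    _ = 1 := mul_one_div_cancel hm.ne'

lemma wt_nonneg {n m : ℕ} {ε : ℚ} (hε0 : 0 < ε) (i : Fin n) : 0 ≤ wt n m ε i := by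
  unfold wt
  split_ifs <;> linarith

lemma sum_wt_fintypePreimage_collide_le_one_iff {n m : ℕ} {ε : ℚ} (hε0 : 0 < ε)
    (hε1 : ε < 1 / (m : ℚ)) {a b : Fin n} (hab : a ≠ b) (ha : n - m ≤ (a : ℕ))
    (hb : n - m ≤ (b : ℕ)) {B : Finset (Option (Fin n))}
    (hB : B ⊆ univ.image (collide a b)) :
    ∑ i ∈ fintypePreimage (collide a b) B, wt n m ε i ≤ 1 ↔ ∑ o ∈ B, wOpt n m ε o ≤ 1 := by
  constructor
  · refine fun h => le_trans ?_ h
    rw [sum_fintypePreimage]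
    refine sum_le_sum fun o ho => ?_
    cases o with
    | none =>
      rw [filter_collide_eq_none, sum_pair hab]
      simp only [wOpt, wt, Option.elim_none, if_neg (not_lt.2 ha), if_neg (not_lt.2 hb)]
      linarith
    | some j => rw [filter_collide_eq_some (hB ho), sum_singleton, wOpt, Option.elim_some]
  · intro h
    by_cases hn : none ∈ B
    · refine sum_wt_le_one_of_light hε0 hε1 fun i hi => ?_
      by_contra! hlt
      rw [mem_fintypePreimage] at hi
      have hi' : collide a b i = some i := by
        refine if_neg ?_
        rintro (rfl | rfl) <;> omega
      rw [hi'] at hi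
      have hpair : ∑ o ∈ {none, some i}, wOpt n m ε o ≤ ∑ o ∈ B, wOpt n m ε o := by
        refine sum_le_sum_of_subset_of_nonneg ?_ ?_
        · simp [insert_subset_iff, hn, hi]
        · rintro (_ | j) - -
          · exact hε0.le
          · exact wt_nonneg hε0 j
      rw [sum_pair (by simp)] at hpair
      simp only [wOpt, wt, Option.elim_none, Option.elim_some, if_pos hlt] at hpair h
      linarith
    · refine le_trans (le_of_eq ?_) h
      rw [sum_fintypePreimage]
      refine sum_congr rfl fun o ho => ?_
      cases o with
      | none => exact absurd ho hn
      | some j => rw [filter_collide_eq_some (hB ho), sum_singleton, wOpt, Option.elim_some]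

/-- the displayed identity in Case 2 of the proof of
Lemma A.2 / `lem:not-colliding`: for distinct light indices `t₂, N`, the alternating
sum over the totally `w`-unstable partitions of `{1,…,n}` in which `t₂` and `N` lie in
the same block equals minus the corresponding alternating sum for the modified marked
set `S' = ({1,…,n} ∖ {t₂, N}) ∪ {★}`, where the fresh light element `★ = none` carries
the exponent `k_{t₂} + k_N − 1`. -/
theorem colliding_sum_eq_neg_merged_sum
    (n m : ℕ) (ε : ℚ) (hn : 4 ≤ n) (hnm : m + 2 ≤ n) (hε0 : 0 < ε) (hε1 : ε < 1 / (m : ℚ))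
    (t2 N : Fin n) (ht2N : t2 ≠ N)
    (ht2light : n - m ≤ (t2 : ℕ)) (hNlight : n - m ≤ (N : ℕ)) (k : Fin n → ℕ) :
    ∑ P ∈ (unstablePartitions (wt n m ε) Finset.univ).filter
          (fun P => ∃ B ∈ P, t2 ∈ B ∧ N ∈ B),
        (-1 : ℤ) ^ (n - P.card) * Mcoef (fun i => (k i : ℤ)) P
    = - ∑ Q ∈ unstablePartitions (wOpt n m ε)
            (insert none ((Finset.univ \ {t2, N}).image some)),
          (-1 : ℤ) ^ ((insert (none : Option (Fin n))
              ((Finset.univ \ {t2, N}).image some)).card - Q.card) *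
            Mcoef (fun o => o.elim ((k t2 : ℤ) + (k N : ℤ) - 1) (fun i => (k i : ℤ))) Q := by
  rw [← univ_image_collide, ← sum_neg_distrib]
  set f := collide t2 N with hf
  have hinj {Q : Finset (Finset (Option (Fin n)))} (hQ : IsPartition (univ.image f) Q) :
      Set.InjOn (fintypePreimage f) Q := fun B hB C hC h => by
    rw [← image_fintypePreimage (hQ.subset hB), h, image_fintypePreimage (hQ.subset hC)]
  have hunst {Q : Finset (Finset (Option (Fin n)))} (hQ : IsPartition (univ.image f) Q) :
      TotallyUnstable (wt n m ε) (Q.image (fintypePreimage f)) ↔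
        TotallyUnstable (wOpt n m ε) Q := by
    simp only [TotallyUnstable, forall_mem_image]
    exact forall₂_congr fun B hB => sum_wt_fintypePreimage_collide_le_one_iff hε0 hε1 ht2N
      ht2light hNlight (hQ.subset hB)
  symm
  refine sum_bij (fun Q _ => Q.image (fintypePreimage f)) ?_ ?_ ?_ ?_
  · intro Q hQ
    obtain ⟨hQ, hw⟩ := mem_unstablePartitions.1 hQ
    refine mem_filter.2 ⟨mem_unstablePartitions.2 ⟨hQ.image_fintypePreimage, (hunst hQ).2 hw⟩, ?_⟩
    have hnone : none ∈ Q.biUnion id := by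
      rw [hQ.2.2, hf, univ_image_collide]
      exact mem_insert_self _ _
    obtain ⟨B, hB, hnB⟩ := mem_biUnion.1 hnone
    refine ⟨_, mem_image_of_mem _ hB, ?_, ?_⟩
    · rwa [mem_fintypePreimage, hf, collide_eq_none.2 (Or.inl rfl)]
    · rwa [mem_fintypePreimage, hf, collide_eq_none.2 (Or.inr rfl)]
  · intro Q hQ R hR h
    rw [← image_image_fintypePreimage (mem_unstablePartitions.1 hQ).1, h,
      image_image_fintypePreimage (mem_unstablePartitions.1 hR).1]
  · intro P hP
    obtain ⟨hP, hcol⟩ := mem_filter.1 hP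
    obtain ⟨hP, hw⟩ := mem_unstablePartitions.1 hP
    have hsat : ∀ B ∈ P, fintypePreimage f (B.image f) = B := fun B hB =>
      fintypePreimage_image_collide hP hcol hB
    have hback : (P.image (image f)).image (fintypePreimage f) = P := by
      rw [Finset.image_image]
      conv_rhs => rw [← image_id (s := P)]
      exact image_congr hsat
    have hQ := hP.image_image hsat
    exact ⟨_, mem_unstablePartitions.2 ⟨hQ, (hunst hQ).1 (hback.symm ▸ hw)⟩, hback⟩
  · intro Q hQ
    have hQ := (mem_unstablePartitions.1 hQ).1
    rw [Mcoef_image _ _ Q _ (hinj hQ) fun B hB =>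
      Kblock_fintypePreimage_collide ht2N (fun i => (k i : ℤ)) (hQ.subset hB),
      card_image_of_injOn (hinj hQ)]
    have hcard : (univ.image f).card + 1 = n := by
      simpa using card_univ_image_collide ht2N
    have hsub : n - Q.card = (univ.image f).card - Q.card + 1 := by
      have := hQ.card_le
      omega
    rw [hsub, pow_succ]
    ring
end

section
/- Suppose n − m = 2, i.e. there are exactly 2 heavy indices. Then for N ∈ {1,…,n}, the cardinality of V_{N,w} equals m if N is heavy (N ≤ 2), and equals 2m − 2 if N is light (N > 2). -/
open Finset

/-- `V_{N,w}`: the set of 2-element subsets `S ⊆ {1,…,n} ∖ {N}` such that both `S`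
and its complement have total weight at least `1`. -/
def Vset (n m : ℕ) (ε : ℚ) (N : Fin n) : Finset (Finset (Fin n)) :=
  Finset.univ.filter (fun S => S.card = 2 ∧ N ∉ S ∧
    1 ≤ ∑ i ∈ S, wt n m ε i ∧ 1 ≤ ∑ i ∈ Sᶜ, wt n m ε i)

/-- The light indices are too light to reach weight `1`, so a set does so exactly when it
contains a heavy index. -/
theorem one_le_sum_wt_iff {n m : ℕ} {ε : ℚ} (hmn : m ≤ n) (hε0 : 0 < ε)
    (hε1 : ε < 1 / (m : ℚ)) (T : Finset (Fin n)) :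
    1 ≤ ∑ i ∈ T, wt n m ε i ↔ ∃ i ∈ T, (i : ℕ) < n - m := by
  constructor
  · intro h
    by_contra! hT
    have hsum : ∑ i ∈ T, wt n m ε i = T.card * ε := by
      rw [← nsmul_eq_mul]
      exact Finset.sum_eq_card_nsmul fun i hi => if_neg (not_lt.2 (hT i hi))
    have hcard : T.card ≤ m := by
      have hle := Finset.card_le_card_of_injOn (t := Finset.Ico (n - m) n) (fun i : Fin n => (i : ℕ))
        (fun i hi => Finset.mem_coe.2 (Finset.mem_Ico.2 ⟨hT i hi, i.2⟩))
        Fin.val_injective.injOn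
      rw [Nat.card_Ico] at hle
      omega
    have hm : (0 : ℚ) < m := one_div_pos.1 (hε0.trans hε1)
    have hmε : ε * m < 1 := (lt_div_iff₀ hm).1 hε1
    have hcard' : (T.card : ℚ) * ε ≤ m * ε := by gcongr
    linarith
  · rintro ⟨i, hi, hlt⟩
    calc (1 : ℚ) = wt n m ε i := (if_pos hlt).symm
      _ ≤ ∑ i ∈ T, wt n m ε i := Finset.single_le_sum (f := wt n m ε)
          (fun j _ => by unfold wt; split_ifs <;> linarith) hi

/-- With two heavy indices, `V_{N,w}` consists of the pairs of a heavy and a light index,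
both different from `N`. -/
theorem Vset_eq_image {n m : ℕ} {ε : ℚ} (hε0 : 0 < ε) (hε1 : ε < 1 / (m : ℚ))
    (h2 : n - m = 2) (N : Fin n) :
    Vset n m ε N =
      (((univ.filter fun i : Fin n => (i : ℕ) < 2).erase N) ×ˢ
        ((univ.filter fun i : Fin n => ¬ (i : ℕ) < 2).erase N)).image
          fun p => {p.1, p.2} := by
  ext S
  simp only [Vset, one_le_sum_wt_iff (show m ≤ n by omega) hε0 hε1, h2, mem_filter, mem_univ,
    true_and, mem_image, mem_product, mem_erase, mem_compl, Prod.exists]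
  constructor
  · rintro ⟨hcard, hN, ⟨x, hx, hx2⟩, z, hz, hz2⟩
    obtain ⟨y, hxy, rfl⟩ : ∃ y, x ≠ y ∧ S = {x, y} := by
      obtain ⟨a, b, hab, rfl⟩ := Finset.card_eq_two.1 hcard
      rcases Finset.mem_insert.1 hx with rfl | hx
      · exact ⟨b, hab, rfl⟩
      · rw [Finset.mem_singleton.1 hx]
        exact ⟨a, hab.symm, Finset.pair_comm a b⟩
    simp only [mem_insert, mem_singleton, not_or, Fin.ext_iff] at hN hz hxy
    refine ⟨x, y, ⟨⟨fun h => hN.1 ?_, hx2⟩, fun h => hN.2 ?_, ?_⟩, rfl⟩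
    · rw [h]
    · rw [h]
    · omega
  · rintro ⟨x, y, ⟨⟨hxN, hx2⟩, hyN, hy2⟩, rfl⟩
    refine ⟨Finset.card_pair fun h => hy2 (h ▸ hx2), by simp [hxN.symm, hyN.symm],
      ⟨x, by simp, hx2⟩, ⟨1 - x, by omega⟩, ?_, ?_⟩
    · simp only [mem_insert, mem_singleton, Fin.ext_iff]
      omega
    · simp only
      omega

/-- An unordered pair with one entry satisfying `p` and one not determines the ordered pair. -/
theorem injOn_pair_of_separated {α : Type*} [DecidableEq α] (p : α → Prop) :
    Set.InjOn (fun q : α × α => ({q.1, q.2} : Finset α)) {q | p q.1 ∧ ¬ p q.2} := by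
  rintro ⟨a, b⟩ ⟨ha, hb⟩ ⟨c, d⟩ ⟨hc, hd⟩ h
  have ha' : a ∈ ({c, d} : Finset α) := by rw [← show ({a, b} : Finset α) = {c, d} from h]; simp
  have hb' : b ∈ ({c, d} : Finset α) := by rw [← show ({a, b} : Finset α) = {c, d} from h]; simp
  simp only [mem_insert, mem_singleton] at ha' hb'
  grind

/-- Lemma `lem:primitive-vectors-number`, case (i): when there are
exactly `2` heavy indices, `|V_{N,w}| = m` if `N` is heavy and `|V_{N,w}| = 2m − 2`
if `N` is light. -/
theorem card_Vset_two_heavy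
    (n m : ℕ) (ε : ℚ) (hn : 4 ≤ n) (hnm : m + 2 ≤ n) (hε0 : 0 < ε) (hε1 : ε < 1 / (m : ℚ))
    (h2 : n - m = 2) (N : Fin n) :
    ((N : ℕ) < n - m → (Vset n m ε N).card = m) ∧
    (n - m ≤ (N : ℕ) → (Vset n m ε N).card = 2 * m - 2) := by
  have hheavy : (univ.filter fun i : Fin n => (i : ℕ) < 2).card = 2 := by
    rw [Fin.card_filter_val_lt]
    omega
  have hlight : (univ.filter fun i : Fin n => ¬ (i : ℕ) < 2).card = m := by
    have := Finset.card_filter_add_card_filter_not (s := univ) fun i : Fin n => (i : ℕ) < 2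
    rw [hheavy, Finset.card_univ, Fintype.card_fin] at this
    omega
  rw [Vset_eq_image hε0 hε1 h2, Finset.card_image_of_injOn, Finset.card_product, h2]
  · constructor <;> intro hN
    · rw [Finset.card_erase_of_mem (by simpa using hN),
        Finset.erase_eq_of_notMem (by simpa using hN),
        hheavy, hlight]
      omega
    · rw [Finset.erase_eq_of_notMem (by simp only [mem_filter, mem_univ, true_and]; omega),
        Finset.card_erase_of_mem (by simp only [mem_filter, mem_univ, true_and]; omega),
        hheavy, hlight]
      omega
  · refine (injOn_pair_of_separated fun i : Fin n => (i : ℕ) < 2).mono ?_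
    intro q hq
    simp only [coe_product, Set.mem_prod, mem_coe, mem_erase, mem_filter] at hq
    exact ⟨hq.1.2.2, hq.2.2.2⟩
end

section
/- Suppose n − m > 2, i.e. there are more than 2 heavy indices. Then for N ∈ {1,…,n}, the cardinality of V_{N,w} equals C(n−1, 2) − C(m, 2) if N is heavy (N ≤ n − m), and equals C(n−1, 2) − C(m−1, 2) if N is light (N > n − m), where C(a, 2) denotes the binomial coefficient a choose 2. -/
open Finset

/-- The light indices, those of weight `ε`. -/
def lightIndices (n m : ℕ) : Finset (Fin n) := {i | n - m ≤ (i : ℕ)}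

lemma mem_lightIndices {n m : ℕ} {i : Fin n} : i ∈ lightIndices n m ↔ n - m ≤ (i : ℕ) := by
  simp [lightIndices]

lemma card_compl_lightIndices (n m : ℕ) : ((lightIndices n m)ᶜ).card = n - m := by
  have h : (lightIndices n m)ᶜ = ({i | (i : ℕ) < n - m} : Finset (Fin n)) := by
    ext i
    rw [mem_compl, mem_lightIndices, mem_filter_univ, not_le]
  rw [h, Fin.card_filter_val_lt, min_eq_right (Nat.sub_le n m)]

lemma card_lightIndices {n m : ℕ} (h : m ≤ n) : (lightIndices n m).card = m := by
  have h1 := Finset.card_add_card_compl (lightIndices n m)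
  rw [card_compl_lightIndices, Fintype.card_fin] at h1
  omega

lemma one_le_sum_wt {n m : ℕ} {ε : ℚ} (hε : 0 ≤ ε) {S : Finset (Fin n)}
    (hS : ∃ i ∈ S, i ∉ lightIndices n m) : 1 ≤ ∑ i ∈ S, wt n m ε i := by
  obtain ⟨i, hi, hl⟩ := hS
  have hwt : wt n m ε i = 1 := if_pos (not_le.1 (mem_lightIndices.not.1 hl))
  rw [← hwt]
  refine Finset.single_le_sum (f := wt n m ε) (fun j _ => ?_) hi
  unfold wt
  split_ifs <;> linarith

lemma sum_wt_of_subset_lightIndices {n m : ℕ} (ε : ℚ) {S : Finset (Fin n)}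
    (hS : S ⊆ lightIndices n m) : ∑ i ∈ S, wt n m ε i = S.card * ε := by
  have hwt : ∀ i ∈ S, wt n m ε i = ε := fun i hi =>
    if_neg (mem_lightIndices.1 (hS hi)).not_gt
  rw [Finset.sum_congr rfl hwt, Finset.sum_const, nsmul_eq_mul]

lemma Vset_eq_sdiff {n m : ℕ} {ε : ℚ} (hmn : m ≤ n) (hε0 : 0 < ε) (hε1 : ε < 1 / (m : ℚ))
    (h2 : 2 < n - m) (N : Fin n) :
    Vset n m ε N = powersetCard 2 (univ.erase N) \ powersetCard 2 ((lightIndices n m).erase N) := by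
  ext S
  simp only [Vset, mem_filter, mem_univ, true_and, mem_sdiff, mem_powersetCard, subset_erase,
    subset_univ]
  constructor
  · rintro ⟨hc, hN, hS, -⟩
    refine ⟨⟨hN, hc⟩, fun ⟨⟨hl, _⟩, _⟩ => ?_⟩
    have hm : 2 ≤ m := by
      rw [← hc, ← card_lightIndices hmn]
      exact card_le_card hl
    have hm' : (2 : ℚ) ≤ m := by exact_mod_cast hm
    rw [lt_div_iff₀ (by linarith)] at hε1
    rw [sum_wt_of_subset_lightIndices ε hl, hc] at hS
    push_cast at hS
    nlinarith
  · rintro ⟨⟨hN, hc⟩, hl⟩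
    refine ⟨hc, hN, one_le_sum_wt hε0.le ?_, one_le_sum_wt hε0.le ?_⟩
    · exact Finset.not_subset.1 fun h => hl ⟨⟨h, hN⟩, hc⟩
    · obtain ⟨i, hi, hiS⟩ := Finset.exists_mem_notMem_of_card_lt_card
        (s := S) (t := (lightIndices n m)ᶜ) (by rw [card_compl_lightIndices]; omega)
      exact ⟨i, mem_compl.2 hiS, mem_compl.1 hi⟩

/-- Lemma `lem:primitive-vectors-number`, case (ii): when there are
more than `2` heavy indices, `|V_{N,w}| = C(n−1,2) − C(m,2)` if `N` is heavy and
`|V_{N,w}| = C(n−1,2) − C(m−1,2)` if `N` is light. -/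
theorem card_Vset_many_heavy
    (n m : ℕ) (ε : ℚ) (hn : 4 ≤ n) (hnm : m + 2 ≤ n) (hε0 : 0 < ε) (hε1 : ε < 1 / (m : ℚ))
    (h2 : 2 < n - m) (N : Fin n) :
    ((N : ℕ) < n - m → (Vset n m ε N).card = Nat.choose (n - 1) 2 - Nat.choose m 2) ∧
    (n - m ≤ (N : ℕ) → (Vset n m ε N).card = Nat.choose (n - 1) 2 - Nat.choose (m - 1) 2) := by
  have hcard : (Vset n m ε N).card =
      Nat.choose (n - 1) 2 - Nat.choose ((lightIndices n m).erase N).card 2 := by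
    rw [Vset_eq_sdiff (by omega) hε0 hε1 h2, card_sdiff_of_subset
      (powersetCard_mono (erase_subset_erase N (subset_univ _))), card_powersetCard,
      card_powersetCard, card_erase_of_mem (mem_univ N), card_univ, Fintype.card_fin]
  have hL : (lightIndices n m).card = m := card_lightIndices (by omega)
  refine ⟨fun hN => ?_, fun hN => ?_⟩
  · rw [hcard, erase_eq_of_notMem (mem_lightIndices.not.2 hN.not_ge), hL]
  · rw [hcard, card_erase_of_mem (mem_lightIndices.2 hN), hL]
end

section
/- For every N ∈ {1,…,n}, the vectors v_S for S ∈ V_{N,w}, together with the image of φ_w, span all of ℝ^{P_w}; equivalently, the images of the vectors {v_S : S ∈ V_{N,w}} under the quotient map ℝ^{P_w} → ℝ^{P_w}/Im(φ_w) span the entire quotient vector space ℝ_w = ℝ^{P_w}/Im(φ_w). -/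
open Finset

/-- The index set `P_w` of coordinates: 2-element subsets `T` of `{1,…,n}` that are not
contained in the set of light indices, i.e. containing at least one heavy index. -/
def PwT (n m : ℕ) : Type := {T : Finset (Fin n) // T.card = 2 ∧ ∃ i ∈ T, (i : ℕ) < n - m}

/-- The linear map `φ_w : ℝⁿ → ℝ^{P_w}`, sending `a` to the vector whose coordinate at
`T = {t₁, t₂}` is `a_{t₁} + a_{t₂}`. -/
def phiW (n m : ℕ) : (Fin n → ℝ) →ₗ[ℝ] (PwT n m → ℝ) where
  toFun a := fun T => ∑ i ∈ T.val, a i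
  map_add' a b := by
    funext T
    exact Finset.sum_add_distrib
  map_smul' c a := by
    funext T
    simp [Finset.mul_sum]

/-- The vector `v_I ∈ ℝ^{P_w}` whose coordinate at `T` is `1` if `|I ∩ T| = 1`
and `0` otherwise. -/
def vI (n m : ℕ) (I : Finset (Fin n)) : PwT n m → ℝ :=
  fun T => if (I ∩ T.val).card = 1 then 1 else 0

instance (n m : ℕ) : DecidableEq (PwT n m) :=
  inferInstanceAs (DecidableEq {T : Finset (Fin n) // T.card = 2 ∧ ∃ i ∈ T, (i : ℕ) < n - m})

instance (n m : ℕ) : Fintype (PwT n m) :=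
  inferInstanceAs (Fintype {T : Finset (Fin n) // T.card = 2 ∧ ∃ i ∈ T, (i : ℕ) < n - m})

/-- For a 2-element set `S` in `P_w`, the vector `v_S` equals `-2 e_S` modulo the image of `φ_w`. -/
lemma vI_eq_phiW_indicator_sub_single {n m : ℕ} (S : PwT n m) :
    vI n m S.val =
      phiW n m (fun i => if i ∈ S.val then 1 else 0) - (2 : ℝ) • Pi.single S (1 : ℝ) := by
  funext T
  have hsum : phiW n m (fun i => if i ∈ S.val then 1 else 0) T = ((S.val ∩ T.val).card : ℝ) := by
    simp [phiW, Finset.inter_comm]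
  rw [Pi.sub_apply, hsum, Pi.smul_apply, vI]
  by_cases h : T = S
  · subst h
    simp [T.2.1]
  · have hlt : (S.val ∩ T.val).card < 2 := by
      refine lt_of_le_of_ne ((card_le_card inter_subset_left).trans S.2.1.le) fun hc => h ?_
      have h1 := eq_of_subset_of_card_le (inter_subset_left (s₁ := S.val) (s₂ := T.val))
        (by rw [hc, S.2.1])
      have h2 := eq_of_subset_of_card_le (inter_subset_right (s₁ := S.val) (s₂ := T.val))
        (by rw [hc, T.2.1])
      exact Subtype.ext (h2.symm.trans h1)
    rw [Pi.single_eq_of_ne h]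
    interval_cases (S.val ∩ T.val).card <;> simp

/-- An element of `P_w` outside `V_{N,w}` contains `N` or is the set of all heavy indices. -/
lemma mem_or_eq_heavy_of_notMem_Vset {n m : ℕ} {ε : ℚ} (hnm : m + 2 ≤ n) (hε0 : 0 < ε)
    {N : Fin n} (T : PwT n m) (hT : T.val ∉ Vset n m ε N) :
    N ∈ T.val ∨ ∀ i : Fin n, i ∈ T.val ↔ (i : ℕ) < n - m := by
  refine or_iff_not_imp_left.2 fun hN => ?_
  have hpos : ∀ i, 0 ≤ wt n m ε i := fun i => by
    unfold wt
    split_ifs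
    exacts [zero_le_one, hε0.le]
  have one_le : ∀ (s : Finset (Fin n)) (i : Fin n), i ∈ s → (i : ℕ) < n - m →
      1 ≤ ∑ j ∈ s, wt n m ε j := fun s i hi hlt => by
    refine le_trans ?_ (single_le_sum (fun j _ => hpos j) hi)
    simp [wt, hlt]
  obtain ⟨a, haT, ha⟩ := T.2.2
  have heavy_mem : ∀ i : Fin n, (i : ℕ) < n - m → i ∈ T.val := fun i hi => by
    by_contra hiT
    exact hT (mem_filter.2
      ⟨mem_univ _, T.2.1, hN, one_le _ a haT ha, one_le _ i (mem_compl.2 hiT) hi⟩)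
  have hpair : ({⟨0, by omega⟩, ⟨1, by omega⟩} : Finset (Fin n)) = T.val := by
    refine eq_of_subset_of_card_le ?_ ?_
    · intro i hi
      apply heavy_mem
      simp only [mem_insert, mem_singleton] at hi
      rcases hi with rfl | rfl <;> simp only <;> omega
    · rw [T.2.1, card_pair (by simp)]
  refine fun i => ⟨fun hi => ?_, heavy_mem i⟩
  rw [← hpair] at hi
  simp only [mem_insert, mem_singleton] at hi
  rcases hi with rfl | rfl <;> simp only <;> omega

/-- A 2-element set with two given distinct members is determined. -/
lemma PwT.eq_of_mem {n m : ℕ} {a b : Fin n} (hab : a ≠ b) {S T : PwT n m}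
    (haS : a ∈ S.val) (hbS : b ∈ S.val) (haT : a ∈ T.val) (hbT : b ∈ T.val) : S = T := by
  have key : ∀ U : PwT n m, a ∈ U.val → b ∈ U.val → ({a, b} : Finset (Fin n)) = U.val :=
    fun U ha hb => eq_of_subset_of_card_le (by simp [insert_subset_iff, ha, hb])
      (by rw [U.2.1, card_pair hab])
  exact Subtype.ext ((key S haS hbS).symm.trans (key T haT hbT))

/-- An edge weighting supported on the edges through `N` and the edge of all heavy indices
vanishes as soon as all its vertex sums do. -/
lemma eq_zero_of_star_sum_eq_zero {n m : ℕ} {N : Fin n} (x : PwT n m → ℝ)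
    (hstar : ∀ j, ∑ T : PwT n m, (if j ∈ T.val then x T else 0) = 0)
    (hx : ∀ T : PwT n m, x T ≠ 0 → N ∈ T.val ∨ ∀ i : Fin n, i ∈ T.val ↔ (i : ℕ) < n - m) :
    x = 0 := by
  by_cases hheavy : ∃ T : PwT n m, N ∉ T.val ∧ ∀ i : Fin n, i ∈ T.val ↔ (i : ℕ) < n - m
  · obtain ⟨T₀, hN, hT₀⟩ := hheavy
    obtain ⟨p, q, hpq, hT₀pq⟩ := card_eq_two.1 T₀.2.1
    have hp : p ∈ T₀.val := by simp [hT₀pq]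
    have hq : q ∈ T₀.val := by simp [hT₀pq]
    have hNp : N ≠ p := fun h => hN (h ▸ hp)
    have hNq : N ≠ q := fun h => hN (h ▸ hq)
    let Tp : PwT n m := ⟨{N, p}, card_pair hNp, p, by simp, (hT₀ p).1 hp⟩
    let Tq : PwT n m := ⟨{N, q}, card_pair hNq, q, by simp, (hT₀ q).1 hq⟩
    have hNTp : N ∈ Tp.val := by simp [Tp]
    have hpTp : p ∈ Tp.val := by simp [Tp]
    have hNTq : N ∈ Tq.val := by simp [Tq]
    have hqTq : q ∈ Tq.val := by simp [Tq]
    have hqTp : q ∉ Tp.val := by simp [Tp, hNq.symm, hpq.symm]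
    have hpTq : p ∉ Tq.val := by simp [Tq, hNp.symm, hpq]
    have h0p : T₀ ≠ Tp := fun h => hN (h ▸ hNTp)
    have h0q : T₀ ≠ Tq := fun h => hN (h ▸ hNTq)
    have hpq' : Tp ≠ Tq := fun h => hpTq (h ▸ hpTp)
    have hsupp : ∀ T, x T ≠ 0 → T = T₀ ∨ T = Tp ∨ T = Tq := by
      intro T hT
      rcases hx T hT with hNT | hT
      · obtain ⟨i, hiT, hi⟩ := T.2.2
        have hi₀ := (hT₀ i).2 hi
        rw [hT₀pq, mem_insert, mem_singleton] at hi₀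
        rcases hi₀ with rfl | rfl
        · exact Or.inr (Or.inl (PwT.eq_of_mem hNp hNT hiT hNTp hpTp))
        · exact Or.inr (Or.inr (PwT.eq_of_mem hNq hNT hiT hNTq hqTq))
      · exact Or.inl (Subtype.ext (Finset.ext fun i => (hT i).trans (hT₀ i).symm))
    have two_terms : ∀ (j : Fin n) (A B C : PwT n m), A ≠ B → j ∈ A.val → j ∈ B.val →
        j ∉ C.val → (∀ T, x T ≠ 0 → T = A ∨ T = B ∨ T = C) → x A + x B = 0 := by
      intro j A B C hAB hA hB hC hABC
      have h := hstar j
      rw [Fintype.sum_eq_add A B hAB, if_pos hA, if_pos hB] at h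
      · exact h
      · rintro T ⟨hTA, hTB⟩
        by_cases hT : x T = 0
        · simp [hT]
        · rcases hABC T hT with h | h | rfl
          exacts [absurd h hTA, absurd h hTB, if_neg hC]
    have e1 := two_terms p T₀ Tp Tq h0p hp hpTp hpTq hsupp
    have e2 := two_terms q T₀ Tq Tp h0q hq hqTq hqTp fun T hT => (hsupp T hT).imp_right Or.symm
    have e3 := two_terms N Tp Tq T₀ hpq' hNTp hNTq hN fun T hT => by
      have := hsupp T hT
      tauto
    funext T
    by_contra hT
    rcases hsupp T hT with rfl | rfl | rfl <;> refine hT ?_ <;> simp only [Pi.zero_apply] <;>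
      linarith
  · have hN : ∀ T, x T ≠ 0 → N ∈ T.val := fun T hT => by
      by_contra hNT
      exact hheavy ⟨T, hNT, (hx T hT).resolve_left hNT⟩
    funext T
    by_contra hT
    obtain ⟨j, hjT, hjN⟩ := exists_mem_ne (by rw [T.2.1]; norm_num) N
    have h := hstar j
    rw [Fintype.sum_eq_single T, if_pos hjT] at h
    · exact hT h
    · intro U hUT
      by_contra hU
      obtain ⟨hjU, hxU⟩ := ite_ne_right_iff.1 hU
      exact hUT (PwT.eq_of_mem hjN hjU (hN U hxU) hjT (hN T hT))

/-- the spanning statement `⟨V_{N,w}⟩ = ℝ_w`: for every `N`, the vectors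
`v_S` for `S ∈ V_{N,w}`, together with the image of `φ_w`, span all of `ℝ^{P_w}`;
equivalently, their images span the quotient `ℝ_w = ℝ^{P_w}/Im(φ_w)`. -/
theorem span_vI_sup_range_phiW_eq_top
    (n m : ℕ) (ε : ℚ) (hn : 4 ≤ n) (hnm : m + 2 ≤ n) (hε0 : 0 < ε) (hε1 : ε < 1 / (m : ℚ))
    (N : Fin n) :
    Submodule.span ℝ (vI n m '' {S | S ∈ Vset n m ε N}) ⊔ LinearMap.range (phiW n m) = ⊤ := by
  by_contra htop
  obtain ⟨f, hf, hker⟩ := Submodule.exists_le_ker_of_lt_top _ (lt_top_iff_ne_top.2 htop)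
  have hphi : ∀ a, f (phiW n m a) = 0 := fun a =>
    hker (Submodule.mem_sup_right (LinearMap.mem_range_self _ a))
  have hstar : ∀ j, ∑ T : PwT n m, (if j ∈ T.val then f (Pi.single T 1) else 0) = 0 := by
    intro j
    refine Eq.trans (sum_congr rfl fun T _ => ?_)
      ((LinearMap.pi_apply_eq_sum_univ f _).symm.trans (hphi (Pi.single j 1)))
    have hsingle : (fun U => if T = U then (1 : ℝ) else 0) = Pi.single T 1 := by
      funext U
      simp [Pi.single_apply, eq_comm]
    have hcoord : phiW n m (Pi.single j 1) T = if j ∈ T.val then 1 else 0 := by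
      simp [phiW, Pi.single_apply]
    rw [hsingle, hcoord, ite_smul, one_smul, zero_smul]
  have hzero := eq_zero_of_star_sum_eq_zero (N := N) (fun T => f (Pi.single T 1)) hstar
    fun T hT => mem_or_eq_heavy_of_notMem_Vset hnm hε0 T fun hV => hT <| by
      have hv : f (vI n m T.val) = 0 :=
        hker (Submodule.mem_sup_left (Submodule.subset_span ⟨T.val, hV, rfl⟩))
      rw [vI_eq_phiW_indicator_sub_single, map_sub, map_smul, hphi] at hv
      simpa using hv
  refine hf (LinearMap.pi_ext' fun T => LinearMap.ext_ring ?_)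
  simpa using congrFun hzero T
end

section
/- For every N ∈ {1,…,n}, the sum Σ_{S ∈ V_{N,w}} v_S lies in the image of φ_w; that is, the sum of all the vectors v_S over S ∈ V_{N,w} equals zero in the quotient vector space ℝ_w = ℝ^{P_w}/Im(φ_w). -/
open Finset

/-- The number of elements common to two pairs, corrected by the case of equality,
detects whether they share exactly one element. -/
theorem ite_card_inter_eq_one {α : Type*} [DecidableEq α] {S T : Finset α}
    (hS : S.card = 2) (hT : T.card = 2) :
    (if (S ∩ T).card = 1 then (1 : ℝ) else 0) =
      (∑ i ∈ T, if i ∈ S then (1 : ℝ) else 0) - 2 * if S = T then 1 else 0 := by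
  have hsum : (∑ i ∈ T, if i ∈ S then (1 : ℝ) else 0) = ((S ∩ T).card : ℝ) := by
    rw [Finset.sum_boole, Finset.filter_mem_eq_inter, Finset.inter_comm]
  rw [hsum]
  by_cases h : S = T
  · subst h
    simp [hS]
  · have hlt : (S ∩ T).card < 2 := by
      by_contra! hle
      have h1 : S ∩ T = S := Finset.eq_of_subset_of_card_le Finset.inter_subset_left (by omega)
      have h2 : S ∩ T = T := Finset.eq_of_subset_of_card_le Finset.inter_subset_right (by omega)
      exact h (h1.symm.trans h2)
    interval_cases hc : (S ∩ T).card <;> simp [h]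

/-- A sum of vectors `v_S` over pairs `S` is `T ↦ ∑_{i ∈ T} deg i - 2 [T ∈ V]`. -/
theorem sum_vI_apply {n m : ℕ} {V : Finset (Finset (Fin n))} (hV : ∀ S ∈ V, S.card = 2)
    (T : PwT n m) :
    (∑ S ∈ V, vI n m S) T =
      (∑ i ∈ T.val, ∑ S ∈ V, if i ∈ S then (1 : ℝ) else 0) -
        2 * if T.val ∈ V then 1 else 0 := by
  rw [Finset.sum_apply, Finset.sum_comm]
  have h : ∀ S ∈ V, vI n m S T =
      (∑ i ∈ T.val, if i ∈ S then (1 : ℝ) else 0) - 2 * if S = T.val then 1 else 0 :=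
    fun S hS => ite_card_inter_eq_one (hV S hS) T.property.1
  rw [Finset.sum_congr rfl h, Finset.sum_sub_distrib, ← Finset.mul_sum, Finset.sum_ite_eq']

/-- A set containing every heavy index has at least `n - m` elements. -/
theorem sub_le_card_of_heavy_mem {n m : ℕ} {T : Finset (Fin n)}
    (hall : ∀ j ∉ T, n - m ≤ (j : ℕ)) : n - m ≤ T.card := by
  have hsub : (Finset.univ.filter fun j : Fin n => (j : ℕ) < n - m) ⊆ T := fun j hj => by
    by_contra hjT
    exact absurd (Finset.mem_filter.1 hj).2 (hall j hjT).not_gt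
  have hcard := Finset.card_le_card hsub
  rw [Fin.card_filter_val_lt] at hcard
  omega

/-- A pair `T` in `P_w` belongs to `V_{N,w}` iff it avoids `N` and misses a heavy index. -/
theorem mem_Vset_iff {n m : ℕ} {ε : ℚ} (hnm : m + 2 ≤ n) (hε0 : 0 < ε)
    (hε1 : ε < 1 / (m : ℚ)) (N : Fin n) (T : PwT n m) :
    T.val ∈ Vset n m ε N ↔ N ∉ T.val ∧ ∃ j ∉ T.val, (j : ℕ) < n - m := by
  obtain ⟨T, hT, i, hi, hin⟩ := T
  have hm : 0 < m := by
    rcases Nat.eq_zero_or_pos m with rfl | h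
    · simp at hε1
      exact absurd hε0 hε1.not_gt
    · exact h
  have hmε : m * ε < 1 := by
    rw [lt_div_iff₀ (by exact_mod_cast hm)] at hε1
    linarith
  have hpos : ∀ k, 0 ≤ wt n m ε k := fun k => by
    unfold wt
    split_ifs <;> linarith
  have hge : ∀ (U : Finset (Fin n)) (k : Fin n), k ∈ U → (k : ℕ) < n - m →
      1 ≤ ∑ l ∈ U, wt n m ε l := fun U k hk hkn => by
    have := Finset.single_le_sum (f := wt n m ε) (fun l _ => hpos l) hk
    simpa [wt, hkn] using this
  simp only [Vset, Finset.mem_filter, Finset.mem_univ, true_and, hT]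
  constructor
  · rintro ⟨hN, -, hc⟩
    refine ⟨hN, ?_⟩
    by_contra! hall
    have hcard := sub_le_card_of_heavy_mem hall
    rw [hT] at hcard
    have hsum : ∑ l ∈ Tᶜ, wt n m ε l = Tᶜ.card * ε := by
      rw [← nsmul_eq_mul]
      refine Finset.sum_eq_card_nsmul fun l hl => ?_
      simp [wt, (hall l (Finset.mem_compl.1 hl)).not_gt]
    have hTc : Tᶜ.card = m := by
      rw [Finset.card_compl, Fintype.card_fin, hT]
      omega
    rw [hsum, hTc] at hc
    linarith
  · rintro ⟨hN, j, hj, hjn⟩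
    exact ⟨hN, hge _ i hi hin, hge _ j (Finset.mem_compl.2 hj) hjn⟩

/-- The indicator function of `V_{N,w}` on `P_w` lies in the image of `φ_w`. -/
theorem exists_sum_eq_indicator_Vset {n m : ℕ} {ε : ℚ} (hnm : m + 2 ≤ n) (hε0 : 0 < ε)
    (hε1 : ε < 1 / (m : ℚ)) (N : Fin n) :
    ∃ b : Fin n → ℝ, ∀ T : PwT n m,
      ∑ i ∈ T.val, b i = if T.val ∈ Vset n m ε N then 1 else 0 := by
  simp only [mem_Vset_iff hnm hε0 hε1]
  by_cases hc : n - m = 2 ∧ 2 ≤ (N : ℕ)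
  · refine ⟨fun i => if n - m ≤ (i : ℕ) ∧ i ≠ N then 1 else 0, ?_⟩
    rintro ⟨T, hT, i, hi, hin⟩
    obtain ⟨x, hxT⟩ := Finset.card_eq_one.1 (show (T.erase i).card = 1 by
      rw [Finset.card_erase_of_mem hi, hT])
    have hx : x ∈ T.erase i := by simp [hxT]
    have hxi : x ≠ i := Finset.ne_of_mem_erase hx
    obtain rfl : T = {i, x} := by rw [← hxT, Finset.insert_erase hi]
    have hiN : i ≠ N := by
      rintro rfl
      omega
    have hmiss : (∃ j ∉ ({i, x} : Finset (Fin n)), (j : ℕ) < n - m) ↔ n - m ≤ (x : ℕ) := by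
      constructor
      · rintro ⟨j, hj, hjn⟩
        simp only [Finset.mem_insert, Finset.mem_singleton, not_or, Fin.ext_iff] at hj
        have := Fin.val_ne_of_ne hxi
        omega
      · intro hxl
        refine ⟨⟨1 - (i : ℕ), by omega⟩, ?_, by simp only; omega⟩
        simp only [Finset.mem_insert, Finset.mem_singleton, not_or, Fin.ext_iff]
        omega
    rw [if_congr (and_congr_right fun _ => hmiss) rfl rfl]
    simp only [Finset.sum_pair hxi.symm, not_le.2 hin, Finset.mem_insert,
      Finset.mem_singleton, hiN.symm, false_and, if_false, zero_add, false_or]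
    exact if_congr (by rw [and_comm, ne_comm]) rfl rfl
  · refine ⟨fun i => 1 / 2 - if i = N then 1 else 0, ?_⟩
    rintro ⟨T, hT, -⟩
    have hmiss : N ∉ T → ∃ j ∉ T, (j : ℕ) < n - m := fun hN => by
      by_cases hNn : (N : ℕ) < n - m
      · exact ⟨N, hN, hNn⟩
      · by_contra! hall
        have hcard := sub_le_card_of_heavy_mem hall
        rw [hT] at hcard
        omega
    simp only [and_iff_left_of_imp hmiss, Finset.sum_sub_distrib, Finset.sum_ite_eq',
      Finset.sum_const, hT]
    by_cases hN : N ∈ T <;> simp [hN]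

/-- the relation `∑_{v_S ∈ V_{N,w}} v_S = 0` in `ℝ_w`: for every `N`,
the sum of the vectors `v_S` over `S ∈ V_{N,w}` lies in the image of `φ_w`, i.e. it
vanishes in the quotient `ℝ_w = ℝ^{P_w}/Im(φ_w)`. -/
theorem sum_vI_mem_range_phiW
    (n m : ℕ) (ε : ℚ) (hn : 4 ≤ n) (hnm : m + 2 ≤ n) (hε0 : 0 < ε) (hε1 : ε < 1 / (m : ℚ))
    (N : Fin n) :
    (∑ S ∈ Vset n m ε N, vI n m S) ∈ LinearMap.range (phiW n m) := by
  obtain ⟨b, hb⟩ := exists_sum_eq_indicator_Vset hnm hε0 hε1 N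
  refine ⟨fun i => (∑ S ∈ Vset n m ε N, if i ∈ S then (1 : ℝ) else 0) - 2 * b i, ?_⟩
  funext T
  rw [sum_vI_apply (fun S hS => (Finset.mem_filter.1 hS).2.1), ← hb T, Finset.mul_sum,
    ← Finset.sum_sub_distrib]
  rfl
end
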